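/- arXiv:2506.01343 — 3 statements merged into one kernel-verified Lean document; each statement's English description precedes it below -/
import Mathlib

section
/- Let S_1, …, S_n be nonempty finite sets, let x_q : S_q → ℝ be weight functions with x_q(j) ≥ 0 and Σ_{j ∈ S_q} x_q(j) = 1 for each q, and let u_q : S_q → ℝ be arbitrary functions. Then Σ_{s ∈ S_1 × ⋯ × S_n} ( ∏_{q=1}^n x_q(s_q) ) · max_{1 ≤ q ≤ n} u_q(s_q) = Σ_{q=1}^n Σ_{j ∈ S_q} u_q(j) · x_q(j) · ∏_{r < q} ( Σ_{k ∈ S_r : u_r(k) < u_q(j)} x_r(k) ) · ∏_{r > q} ( Σ_{k ∈ S_r : u_r(k) ≤ u_q(j)} x_r(k) ). In particular, the expected value of the maximum utility under the product distribution is given by a sum of at most Σ_q |S_q| explicitly computable terms. -/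
open scoped Classical

/-- A finite nonempty family of values in a linear order has a unique first index attaining the
maximum. -/
theorem existsUnique_first_argmax {ι α : Type*} [LinearOrder ι] [Fintype ι] [Nonempty ι]
    [LinearOrder α] (v : ι → α) :
    ∃! q, (∀ r < q, v r < v q) ∧ ∀ r, q < r → v r ≤ v q := by
  obtain ⟨m, hm⟩ := Finite.exists_max v
  have hne : (Finset.univ.filter fun q => v q = v m).Nonempty := ⟨m, by simp⟩
  obtain ⟨q, hq⟩ := Finset.exists_minimal hne
  have hqm : v q = v m := by simpa using hq.prop
  refine ⟨q, ⟨fun r hr => ?_, fun r _ => hqm ▸ hm r⟩, fun p hp => ?_⟩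
  · refine lt_of_le_of_ne (hqm ▸ hm r) fun h => ?_
    exact hr.not_ge (hq.le_of_le (by simp [h, hqm]) hr.le)
  · rcases lt_trichotomy p q with h | h | h
    · refine absurd (hq.le_of_le ?_ h.le) h.not_ge
      simpa using le_antisymm (hm p) (hqm ▸ hp.2 q h)
    · exact h
    · exact absurd (hp.1 q h) (hqm ▸ (hm p)).not_gt

/-- The weight of the strategies for which player `q` plays `j` and every other player `r` plays in
`A r` (for `r < q`) or `B r` (for `q < r`), as a sum over joint strategies. -/
theorem mul_prod_sum_mul_prod_sum {ι R : Type*} [LinearOrder ι] [Fintype ι]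
    [LocallyFiniteOrderBot ι] [LocallyFiniteOrderTop ι] [CommSemiring R]
    {S : ι → Type*} [∀ q, Fintype (S q)]
    (x : ∀ q, S q → R) (q : ι) (j : S q) (A B : ∀ r, Finset (S r)) :
    x q j * (∏ r ∈ Finset.Iio q, ∑ k ∈ A r, x r k) * (∏ r ∈ Finset.Ioi q, ∑ k ∈ B r, x r k)
      = ∑ s : ∀ r, S r, if j = s q ∧ (∀ r < q, s r ∈ A r) ∧ ∀ r, q < r → s r ∈ B r
          then ∏ r, x r (s r) else 0 := by
  let t : ∀ r, Finset (S r) := Function.update (fun r => if r < q then A r else B r) q {j}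
  have htq : t q = {j} := by simp [t]
  have htA : ∀ r < q, t r = A r := fun r hr => by simp [t, hr.ne, hr]
  have htB : ∀ r, q < r → t r = B r := fun r hr => by simp [t, hr.ne', hr.not_gt]
  have huniv : (Finset.univ : Finset ι) = insert q (Finset.Iio q ∪ Finset.Ioi q) := by
    ext r
    simpa using (lt_trichotomy r q).elim (fun h => Or.inr (Or.inl h))
      (fun h => h.elim Or.inl fun h => Or.inr (Or.inr h))
  have hdisj : Disjoint (Finset.Iio q) (Finset.Ioi q) :=
    Finset.disjoint_left.2 fun r h h' => lt_asymm (Finset.mem_Iio.1 h) (Finset.mem_Ioi.1 h')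
  have hprod : ∏ r, ∑ k ∈ t r, x r k
      = x q j * (∏ r ∈ Finset.Iio q, ∑ k ∈ A r, x r k) * ∏ r ∈ Finset.Ioi q, ∑ k ∈ B r, x r k := by
    rw [huniv, Finset.prod_insert (by simp), Finset.prod_union hdisj, htq, Finset.sum_singleton,
      mul_assoc]
    congr 2
    · exact Finset.prod_congr rfl fun r hr => by rw [htA r (Finset.mem_Iio.1 hr)]
    · exact Finset.prod_congr rfl fun r hr => by rw [htB r (Finset.mem_Ioi.1 hr)]
  rw [← hprod, Finset.prod_univ_sum, ← Finset.sum_filter]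
  refine Finset.sum_congr ?_ fun _ _ => rfl
  ext s
  simp only [Fintype.mem_piFinset, Finset.mem_filter, Finset.mem_univ, true_and]
  constructor
  · intro h
    refine ⟨?_, fun r hr => htA r hr ▸ h r, fun r hr => htB r hr ▸ h r⟩
    have := h q
    rw [htq, Finset.mem_singleton] at this
    exact this.symm
  · rintro ⟨hj, hA, hB⟩ r
    rcases lt_trichotomy r q with h | rfl | h
    · exact htA r h ▸ hA r h
    · rw [htq, hj]
      exact Finset.mem_singleton_self _
    · exact htB r h ▸ hB r h

/-- Correctness of the Max-Polymatrix expected-utility decomposition (own action fixed):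
the expectation, under a product distribution, of the maximum of the `n` utility values
equals an explicit double sum over players `q` and strategies `j ∈ S q`. -/
theorem stmt_2 (n : ℕ) (hn : 1 ≤ n) (S : Fin n → Type*) [∀ q, Fintype (S q)]
    [∀ q, Nonempty (S q)]
    (x : ∀ q, S q → ℝ) (hx : ∀ q j, 0 ≤ x q j) (hx1 : ∀ q, ∑ j : S q, x q j = 1)
    (u : ∀ q, S q → ℝ) :
    (∑ s : ∀ q, S q, (∏ q : Fin n, x q (s q)) *
        Finset.univ.sup' ⟨⟨0, hn⟩, Finset.mem_univ _⟩ (fun q => u q (s q)))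
    = ∑ q : Fin n, ∑ j : S q, u q j * x q j
        * (∏ r ∈ Finset.Iio q, ∑ k ∈ Finset.univ.filter (fun k : S r => u r k < u q j), x r k)
        * (∏ r ∈ Finset.Ioi q, ∑ k ∈ Finset.univ.filter (fun k : S r => u r k ≤ u q j), x r k) := by
  have : Nonempty (Fin n) := ⟨⟨0, hn⟩⟩
  simp_rw [mul_assoc, ← mul_assoc (x _ _), mul_prod_sum_mul_prod_sum, Finset.mul_sum]
  simp_rw [Finset.sum_comm (t := (Finset.univ : Finset (∀ q, S q)))]
  refine Finset.sum_congr rfl fun s _ => ?_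
  obtain ⟨q, hq, huniq⟩ := existsUnique_first_argmax fun q => u q (s q)
  have hmax : Finset.univ.sup' ⟨⟨0, hn⟩, Finset.mem_univ _⟩ (fun q => u q (s q)) = u q (s q) := by
    refine le_antisymm (Finset.sup'_le _ _ fun r _ => ?_)
      (Finset.le_sup' (fun q => u q (s q)) (Finset.mem_univ q))
    rcases lt_trichotomy r q with h | rfl | h
    · exact (hq.1 r h).le
    · exact le_rfl
    · exact hq.2 r h
  rw [hmax, Finset.sum_eq_single q, Finset.sum_eq_single (s q)]
  · rw [if_pos (by simpa using hq), mul_comm]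
  · intro j _ hj
    rw [if_neg fun h => hj h.1, mul_zero]
  · simp
  · intro p _ hp
    refine Finset.sum_eq_zero fun j _ => ?_
    rw [if_neg, mul_zero]
    rintro ⟨rfl, h⟩
    exact hp (huniq p (by simpa using h))
  · simp
end

section
/- Let S_0, S_1, …, S_n be nonempty finite sets, let x_q : S_q → ℝ (for q = 0, 1, …, n) be weight functions with x_q(j) ≥ 0 and Σ_{j ∈ S_q} x_q(j) = 1, and let U_q : S_0 × S_q → ℝ (for q = 1, …, n) be arbitrary functions. Then Σ_{(i, s) ∈ S_0 × S_1 × ⋯ × S_n} x_0(i) · ( ∏_{q=1}^n x_q(s_q) ) · max_{1 ≤ q ≤ n} U_q(i, s_q) = Σ_{i ∈ S_0} x_0(i) · Σ_{q=1}^n Σ_{j ∈ S_q} U_q(i, j) · x_q(j) · ∏_{r < q} ( Σ_{k ∈ S_r : U_r(i,k) < U_q(i,j)} x_r(k) ) · ∏_{r > q} ( Σ_{k ∈ S_r : U_r(i,k) ≤ U_q(i,j)} x_r(k) ). That is, in a Max-Polymatrix game, a fixed player's expected utility under a product distribution equals an explicit double sum with at most |S_0| · Σ_q |S_q| terms. 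-/
open scoped Classical

section

variable {ι : Type*} [Fintype ι] [LinearOrder ι] [LocallyFiniteOrderBot ι]
  [LocallyFiniteOrderTop ι]

theorem Finset.prod_univ_eq_mul_prod_Iio_mul_prod_Ioi {M : Type*} [CommMonoid M]
    (f : ι → M) (q : ι) :
    ∏ r, f r = f q * (∏ r ∈ Finset.Iio q, f r) * ∏ r ∈ Finset.Ioi q, f r := by
  have hdisj : Disjoint (Finset.Iio q) (Finset.Ioi q) :=
    Finset.disjoint_left.2 fun r h₁ h₂ =>
      lt_asymm (Finset.mem_Iio.1 h₁) (Finset.mem_Ioi.1 h₂)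
  have hunion : Finset.univ.erase q = (Finset.Iio q).disjUnion (Finset.Ioi q) hdisj := by
    ext r
    simp [lt_or_lt_iff_ne]
  rw [← Finset.mul_prod_erase _ f (Finset.mem_univ q), hunion, Finset.prod_disjUnion, mul_assoc]

/-- The maximum of a finite family is the value at its first maximizer. -/
theorem Finset.sup'_univ_eq_sum_first_maximizer (h : (Finset.univ : Finset ι).Nonempty)
    (v : ι → ℝ) :
    Finset.univ.sup' h v = ∑ q, v q
      * (∏ r ∈ Finset.Iio q, if v r < v q then (1 : ℝ) else 0)
      * (∏ r ∈ Finset.Ioi q, if v r ≤ v q then (1 : ℝ) else 0) := by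
  obtain ⟨m, -, hm⟩ := Finset.exists_mem_eq_sup' h v
  have hmax : ∀ r, v r ≤ v m := fun r => hm ▸ Finset.le_sup' v (Finset.mem_univ r)
  have hne : (Finset.univ.filter fun q => v q = v m).Nonempty := ⟨m, by simp⟩
  obtain ⟨q₀, hq₀⟩ : ∃ q₀, q₀ = (Finset.univ.filter fun q => v q = v m).min' hne := ⟨_, rfl⟩
  have hval : v q₀ = v m := by
    have := Finset.min'_mem _ hne
    rw [← hq₀] at this
    simpa using this
  have hfirst : ∀ r, v r = v m → q₀ ≤ r := fun r hr =>
    hq₀ ▸ Finset.min'_le _ _ (by simpa using hr)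
  rw [Finset.sum_eq_single q₀]
  · rw [Finset.prod_eq_one, Finset.prod_eq_one, hm, hval, mul_one, mul_one]
    · intro r _
      rw [if_pos (hval ▸ hmax r)]
    · intro r hr
      refine if_pos (lt_of_le_of_ne (hval ▸ hmax r) fun h => ?_)
      exact (hfirst r (h.trans hval)).not_gt (Finset.mem_Iio.1 hr)
  · intro q _ hq
    rcases lt_or_gt_of_ne hq with hlt | hgt
    · rw [Finset.prod_eq_zero (s := Finset.Ioi q) (Finset.mem_Ioi.2 hlt), mul_zero]
      refine if_neg fun hle => ?_
      exact (hfirst q (le_antisymm (hmax q) (hval ▸ hle))).not_gt hlt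
    · rw [Finset.prod_eq_zero (s := Finset.Iio q) (Finset.mem_Iio.2 hgt), mul_zero, zero_mul]
      exact if_neg (hval ▸ (hmax q).not_gt)
  · simp

/-- Conditioning on the coordinate `q` factorizes a sum over a product of finite types. -/
theorem Fintype.sum_pi_eq_sum_coord {R : Type*} [CommSemiring R] {S : ι → Type*}
    [∀ q, Fintype (S q)] (q : ι) (f : S q → R) (A : ∀ r, S r → S q → R) :
    ∑ s : ∀ r, S r, f (s q) * (∏ r ∈ Finset.Iio q, A r (s r) (s q))
        * (∏ r ∈ Finset.Ioi q, A r (s r) (s q))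
      = ∑ j, f j * (∏ r ∈ Finset.Iio q, ∑ k, A r k j)
        * (∏ r ∈ Finset.Ioi q, ∑ k, A r k j) := by
  let g (j : S q) : ∀ r, S r → R :=
    Function.update (fun r k => A r k j) q fun k => if k = j then f j else 0
  have hself (j : S q) : g j q = fun k => if k = j then f j else 0 := Function.update_self ..
  have hlt (j : S q) {r : ι} (hr : r ∈ Finset.Iio q) : g j r = fun k => A r k j :=
    Function.update_of_ne (Finset.mem_Iio.1 hr).ne ..
  have hgt (j : S q) {r : ι} (hr : r ∈ Finset.Ioi q) : g j r = fun k => A r k j :=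
    Function.update_of_ne (Finset.mem_Ioi.1 hr).ne' ..
  have hright (j : S q) : ∏ r, ∑ k, g j r k = f j * (∏ r ∈ Finset.Iio q, ∑ k, A r k j)
      * (∏ r ∈ Finset.Ioi q, ∑ k, A r k j) := by
    rw [Finset.prod_univ_eq_mul_prod_Iio_mul_prod_Ioi _ q, hself,
      Finset.prod_congr rfl fun r hr => by rw [hlt j hr],
      Finset.prod_congr (s₁ := Finset.Ioi q) rfl fun r hr => by rw [hgt j hr]]
    simp
  have hleft (j : S q) (s : ∀ r, S r) : ∏ r, g j r (s r) = if s q = j then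
      f j * (∏ r ∈ Finset.Iio q, A r (s r) j) * (∏ r ∈ Finset.Ioi q, A r (s r) j) else 0 := by
    rw [Finset.prod_univ_eq_mul_prod_Iio_mul_prod_Ioi _ q, hself,
      Finset.prod_congr rfl fun r hr => by rw [hlt j hr],
      Finset.prod_congr (s₁ := Finset.Ioi q) rfl fun r hr => by rw [hgt j hr]]
    by_cases hj : s q = j <;> simp [hj]
  simp_rw [← hright, Finset.prod_univ_sum, Fintype.piFinset_univ, hleft]
  rw [Finset.sum_comm]
  simp

end

/-- Max-Polymatrix games: the distinguished player's expected utility under a product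
distribution equals an explicit double sum over own actions `i` and opponent/action
pairs `(q, j)`. -/
theorem stmt_3 (n : ℕ) (hn : 1 ≤ n) (S0 : Type*) [Fintype S0] [Nonempty S0]
    (S : Fin n → Type*) [∀ q, Fintype (S q)] [∀ q, Nonempty (S q)]
    (x0 : S0 → ℝ) (hx0 : ∀ i, 0 ≤ x0 i) (hx01 : ∑ i : S0, x0 i = 1)
    (x : ∀ q, S q → ℝ) (hx : ∀ q j, 0 ≤ x q j) (hx1 : ∀ q, ∑ j : S q, x q j = 1)
    (U : ∀ q : Fin n, S0 → S q → ℝ) :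
    (∑ p : S0 × (∀ q, S q), x0 p.1 * (∏ q : Fin n, x q (p.2 q)) *
        Finset.univ.sup' ⟨⟨0, hn⟩, Finset.mem_univ _⟩ (fun q => U q p.1 (p.2 q)))
    = ∑ i : S0, x0 i *
        ∑ q : Fin n, ∑ j : S q, U q i j * x q j
          * (∏ r ∈ Finset.Iio q,
              ∑ k ∈ Finset.univ.filter (fun k : S r => U r i k < U q i j), x r k)
          * (∏ r ∈ Finset.Ioi q,
              ∑ k ∈ Finset.univ.filter (fun k : S r => U r i k ≤ U q i j), x r k) := by
  rw [Fintype.sum_prod_type]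
  refine Finset.sum_congr rfl fun i _ => ?_
  simp_rw [mul_assoc (x0 i), ← Finset.mul_sum]
  congr 1
  have hmax (s : ∀ q, S q) := Finset.sup'_univ_eq_sum_first_maximizer
    ⟨⟨0, hn⟩, Finset.mem_univ _⟩ fun q => U q i (s q)
  simp_rw [hmax, Finset.mul_sum]
  rw [Finset.sum_comm]
  refine Finset.sum_congr rfl fun q _ => ?_
  let A (r : Fin n) (k : S r) (j : S q) : ℝ :=
    x r k * if r < q then (if U r i k < U q i j then 1 else 0)
      else if U r i k ≤ U q i j then 1 else 0
  have hlt {r : Fin n} (hr : r ∈ Finset.Iio q) (k : S r) (j : S q) :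
      A r k j = x r k * if U r i k < U q i j then 1 else 0 := by
    simp only [A, if_pos (Finset.mem_Iio.1 hr)]
  have hgt {r : Fin n} (hr : r ∈ Finset.Ioi q) (k : S r) (j : S q) :
      A r k j = x r k * if U r i k ≤ U q i j then 1 else 0 := by
    simp only [A, if_neg (Finset.mem_Ioi.1 hr).not_gt]
  refine Eq.trans (Finset.sum_congr rfl fun s _ => ?_)
    ((Fintype.sum_pi_eq_sum_coord q (fun j => U q i j * x q j) A).trans
      (Finset.sum_congr rfl fun j _ => ?_))
  · rw [Finset.prod_congr rfl fun r hr => hlt hr (s r) (s q),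
      Finset.prod_congr (s₁ := Finset.Ioi q) rfl fun r hr => hgt hr (s r) (s q),
      Finset.prod_mul_distrib, Finset.prod_mul_distrib,
      Finset.prod_univ_eq_mul_prod_Iio_mul_prod_Ioi (fun r => x r (s r)) q]
    ring
  · congr 1
    · congr 1
      refine Finset.prod_congr rfl fun r hr => ?_
      simp [hlt hr, Finset.sum_filter]
    · refine Finset.prod_congr rfl fun r hr => ?_
      simp [hgt hr, Finset.sum_filter]
end

section
/- Let S_1, …, S_n be nonempty finite sets, let x_q : S_q → ℝ be weight functions with x_q(j) ≥ 0 and Σ_{j ∈ S_q} x_q(j) = 1 for each q, and let u_q : S_q → ℝ be arbitrary functions. Then Σ_{s ∈ S_1 × ⋯ × S_n} ( ∏_{q=1}^n x_q(s_q) ) · min_{1 ≤ q ≤ n} u_q(s_q) = Σ_{q=1}^n Σ_{j ∈ S_q} u_q(j) · x_q(j) · ∏_{r < q} ( Σ_{k ∈ S_r : u_r(k) > u_q(j)} x_r(k) ) · ∏_{r > q} ( Σ_{k ∈ S_r : u_r(k) ≥ u_q(j)} x_r(k) ). That is, the expected value of the minimum of the n utility values under the product distribution admits the analogous explicit decomposition.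 -/
open scoped Classical

/-- Strategy `k` of player `r` is compatible with player `q` being the first one to attain the
minimum, with strategy `j`. -/
def FirstMinCompatible {n : ℕ} {S : Fin n → Type*} (u : ∀ q, S q → ℝ) (q : Fin n) (j : S q)
    (r : Fin n) (k : S r) : Prop :=
  (r < q → u q j < u r k) ∧ (q < r → u q j ≤ u r k) ∧ (r = q → HEq k j)

theorem prod_mul_inf'_eq_sum_firstMinCompatible {n : ℕ} {S : Fin n → Type*} [∀ q, Fintype (S q)]
    (x u : ∀ q, S q → ℝ) (hne : (Finset.univ : Finset (Fin n)).Nonempty) (s : ∀ q, S q) :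
    (∏ q, x q (s q)) * Finset.univ.inf' hne (fun q => u q (s q))
    = ∑ q, ∑ j : S q, u q j *
        ∏ r, if FirstMinCompatible u q j r (s r) then x r (s r) else 0 := by
  set m := Finset.univ.inf' hne (fun q => u q (s q)) with hm
  have hle : ∀ q, m ≤ u q (s q) := fun q => Finset.inf'_le _ (Finset.mem_univ q)
  obtain ⟨p, hp, hmin⟩ : ∃ p, u p (s p) = m ∧ ∀ r, r < p → u r (s r) ≠ m := by
    obtain ⟨a, -, ha⟩ := Finset.exists_mem_eq_inf' hne (fun q => u q (s q))
    obtain ⟨p, hp, h⟩ := (wellFounded_lt (α := Fin n)).has_min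
      {q | u q (s q) = m} ⟨a, ha.symm⟩
    exact ⟨p, hp, fun r hr h' => h r h' hr⟩
  simp only [Finset.prod_ite_zero, Finset.mem_univ, forall_true_left]
  rw [Finset.sum_eq_single p, Finset.sum_eq_single (s p), if_pos, hp, mul_comm]
  · intro r
    refine ⟨fun h => ?_, fun _ => hp ▸ hle r, fun h => by subst h; rfl⟩
    rw [hp]
    exact lt_of_le_of_ne (hle r) (hmin r h).symm
  · intro j _ hj
    rw [if_neg, mul_zero]
    exact fun h => hj (eq_of_heq ((h p).2.2 rfl)).symm
  · simp
  · intro q _ hq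
    refine Finset.sum_eq_zero fun j _ => ?_
    rw [if_neg, mul_zero]
    intro h
    obtain rfl : s q = j := eq_of_heq ((h q).2.2 rfl)
    rcases lt_or_gt_of_ne hq with hlt | hlt
    · exact hmin q hlt (le_antisymm (hp ▸ (h p).2.1 hlt) (hle q))
    · exact absurd ((h p).1 hlt) (not_lt.2 (hp ▸ hle q))
  · simp

theorem prod_sum_firstMinCompatible {n : ℕ} {S : Fin n → Type*} [∀ q, Fintype (S q)]
    (x u : ∀ q, S q → ℝ) (q : Fin n) (j : S q) :
    (∏ r, ∑ k : S r, if FirstMinCompatible u q j r k then x r k else 0)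
    = x q j
        * (∏ r ∈ Finset.Iio q, ∑ k ∈ Finset.univ.filter (fun k : S r => u r k > u q j), x r k)
        * (∏ r ∈ Finset.Ioi q, ∑ k ∈ Finset.univ.filter (fun k : S r => u r k ≥ u q j), x r k) := by
  have huniv : (Finset.univ : Finset (Fin n)) =
      insert q (Finset.Iio q ∪ Finset.Ioi q) := by
    ext r
    simp only [Finset.mem_univ, Finset.mem_insert, Finset.mem_union, Finset.mem_Iio,
      Finset.mem_Ioi, true_iff]
    rcases lt_trichotomy r q with h | h | h <;> simp [h]
  have hdisj : Disjoint (Finset.Iio q) (Finset.Ioi q) :=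
    Finset.disjoint_left.2 fun r h h' =>
      lt_asymm (Finset.mem_Iio.1 h) (Finset.mem_Ioi.1 h')
  rw [huniv, Finset.prod_insert (by simp), Finset.prod_union hdisj, ← mul_assoc]
  congr 1
  · congr 1
    · simp [FirstMinCompatible]
    · refine Finset.prod_congr rfl fun r hr => ?_
      have h := Finset.mem_Iio.1 hr
      simp [FirstMinCompatible, Finset.sum_filter, h, h.ne, h.not_gt]
  · refine Finset.prod_congr rfl fun r hr => ?_
    have h := Finset.mem_Ioi.1 hr
    simp [FirstMinCompatible, Finset.sum_filter, h, h.ne', h.not_gt]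

/-- Min-variant of the expected-maximum decomposition: the expectation, under a product
distribution, of the minimum of the `n` utility values equals an explicit double sum. -/
theorem stmt_4 (n : ℕ) (hn : 1 ≤ n) (S : Fin n → Type*) [∀ q, Fintype (S q)]
    [∀ q, Nonempty (S q)]
    (x : ∀ q, S q → ℝ) (hx : ∀ q j, 0 ≤ x q j) (hx1 : ∀ q, ∑ j : S q, x q j = 1)
    (u : ∀ q, S q → ℝ) :
    (∑ s : ∀ q, S q, (∏ q : Fin n, x q (s q)) *
        Finset.univ.inf' ⟨⟨0, hn⟩, Finset.mem_univ _⟩ (fun q => u q (s q)))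
    = ∑ q : Fin n, ∑ j : S q, u q j * x q j
        * (∏ r ∈ Finset.Iio q, ∑ k ∈ Finset.univ.filter (fun k : S r => u r k > u q j), x r k)
        * (∏ r ∈ Finset.Ioi q, ∑ k ∈ Finset.univ.filter (fun k : S r => u r k ≥ u q j), x r k) := by
  refine (Finset.sum_congr rfl fun s _ => prod_mul_inf'_eq_sum_firstMinCompatible x u _ s).trans ?_
  rw [Finset.sum_comm]
  refine Finset.sum_congr rfl fun q _ => ?_
  rw [Finset.sum_comm]
  refine Finset.sum_congr rfl fun j _ => ?_
  rw [← Finset.mul_sum, mul_assoc, mul_assoc, ← mul_assoc (x q j),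
    ← prod_sum_firstMinCompatible, Finset.prod_univ_sum, Fintype.piFinset_univ]
end
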